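/- Fix K ∈ M_+(ℝ_+×ℝ_+) and let Φ₁ and Φ₂ be N-functions with Φ₂(2t) ≈ Φ₂(t) for t ∈ ℝ_+. Let u₁, u₂ ∈ M_+(ℝ_+) be weights with ∫_{ℝ_+} u₂ = ∞. Define (Sg)(x) = ∫_0^x ∫_0^∞ K(z,y) g(z) dz dy, U₂(x) = ∫_0^x u₂, and let Ψ₁, Ψ₂ be the complementary N-functions of Φ₁, Φ₂. If there is C > 0 such that ρ_{Ψ₂,u₂}(Sg/U₂) ≤ C ρ_{Ψ₁,u₁}(g/u₁) for all g ∈ M_+(ℝ_+), then there is C' > 0 such that ρ_{Φ₁,u₁}(T_K f*) ≤ C' ρ_{Φ₂,u₂}(f*) for all f ∈ M_+(ℝ_+). -/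

import Mathlib

open MeasureTheory Set
open scoped ENNReal

noncomputable section

/-- The positive integral operator `T_K` on `ℝ₊`. -/
def TK (K : ℝ → ℝ → ℝ≥0∞) (f : ℝ → ℝ≥0∞) (x : ℝ) : ℝ≥0∞ :=
  ∫⁻ y in Ioi (0:ℝ), K x y * f y

/-- Distribution function `μ_f(λ) = |{x ∈ ℝ₊ : f x > λ}|`. -/
def distrib (f : ℝ → ℝ≥0∞) (l : ℝ≥0∞) : ℝ≥0∞ :=
  volume {x : ℝ | 0 < x ∧ l < f x}

/-- Nonincreasing rearrangement `f*(t) = inf{λ : μ_f(λ) ≤ t}`. -/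
def rearr (f : ℝ → ℝ≥0∞) (t : ℝ) : ℝ≥0∞ :=
  sInf {l : ℝ≥0∞ | distrib f l ≤ ENNReal.ofReal t}

/-- Extension of a real function to `ℝ≥0∞`. -/
def extE (F : ℝ → ℝ) (a : ℝ≥0∞) : ℝ≥0∞ :=
  if a = ⊤ then ⊤ else ENNReal.ofReal (F a.toReal)

/-- Orlicz–Lorentz gauge functional `ρ_{Φ,u}`. -/
def ogauge (F : ℝ → ℝ) (u : ℝ → ℝ) (f : ℝ → ℝ≥0∞) : ℝ≥0∞ :=
  sInf {l : ℝ≥0∞ | 0 < l ∧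
    (∫⁻ x in Ioi (0:ℝ), extE F (f x / l) * ENNReal.ofReal (u x)) ≤ 1}

/-- `F` is an N-function with density `φ`: `F x = ∫_0^x φ`, `φ` increasing from `ℝ₊` onto `ℝ₊`. -/
def IsNFunction (F φ : ℝ → ℝ) : Prop :=
  StrictMonoOn φ (Ioi 0) ∧ MapsTo φ (Ioi 0) (Ioi 0) ∧ SurjOn φ (Ioi 0) (Ioi 0) ∧
    ∀ x : ℝ, 0 ≤ x → F x = ∫ y in (0:ℝ)..x, φ y

/-- `F(2t) ≈ F(t)` on `ℝ₊`. -/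
def Doubling (F : ℝ → ℝ) : Prop := ∃ C > 0, ∀ t > 0, F (2 * t) ≤ C * F t

/-- A weight: nonnegative, measurable, locally integrable on `ℝ₊`. -/
def IsWeight (u : ℝ → ℝ) : Prop :=
  Measurable u ∧ (∀ x, 0 ≤ u x) ∧ LocallyIntegrableOn u (Ioi 0)

/-- `U(x) = ∫_0^x u`. -/
def Uw (u : ℝ → ℝ) (x : ℝ) : ℝ := ∫ t in (0:ℝ)..x, u t

/-- `Ψ` (with density `ψ`) is the complementary N-function of the N-function `Φ`
(with density `φ`), i.e. `ψ = φ⁻¹` and `Ψ t = ∫_0^t φ⁻¹`. -/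
def IsComplementary (F φ G ψ : ℝ → ℝ) : Prop :=
  IsNFunction F φ ∧ IsNFunction G ψ ∧ InvOn ψ φ (Ioi 0) (Ioi 0)

/-- `g` is the inverse of `f` on `[0,∞)`. -/
def IsInverseOn (g f : ℝ → ℝ) : Prop :=
  (∀ x ≥ 0, g (f x) = x) ∧ (∀ y ≥ 0, f (g y) = y)

/-- Iterated rearrangement `L(t,s) = (K^{*₂})^{*₁}(t,s)`. -/
def iterRearr (K : ℝ → ℝ → ℝ≥0∞) (t s : ℝ) : ℝ≥0∞ :=
  rearr (fun x => rearr (fun y => K x y) s) t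

/-- `α(λ,x) = ∫_x^∞ Φ(λ/U(y)) u(y) dy`. -/
def hardyAlpha (F : ℝ → ℝ) (u : ℝ → ℝ) (lam x : ℝ) : ℝ≥0∞ :=
  ∫⁻ y in Ioi x, extE F (ENNReal.ofReal lam / ENNReal.ofReal (Uw u y)) * ENNReal.ofReal (u y)

/-- `β(λ,x) = ∫_x^∞ Φ(λ/y) u(y) dy`. -/
def hardyBeta (F : ℝ → ℝ) (u : ℝ → ℝ) (lam x : ℝ) : ℝ≥0∞ :=
  ∫⁻ y in Ioi x, ENNReal.ofReal (F (lam / y)) * ENNReal.ofReal (u y)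

/-- The Hardy-averaging conditions (14)–(15) for an N-function `Φ` (density `φ`,
inverse density `ψ = φ⁻¹`) and weight `u`. -/
def HardyConditions (F φ ψ u : ℝ → ℝ) : Prop :=
  ∃ c > 0, (∀ lam > 0, ∀ x > 0,
      extE φ (ENNReal.ofReal c * hardyAlpha F u lam x / ENNReal.ofReal lam) *
        ENNReal.ofReal (Uw u x) ≤ ENNReal.ofReal (lam / c)) ∧
    (∀ lam > 0, ∀ x > 0,
      (∫⁻ y in Ioo (0:ℝ) x,
        extE ψ ((ENNReal.ofReal c * hardyBeta F u lam x / ENNReal.ofReal lam) *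
          ENNReal.ofReal (y / Uw u y)) * ENNReal.ofReal (y * u y / Uw u y))
        ≤ ENNReal.ofReal (lam / c))


/-- The operator `S g (x) = ∫_0^x ∫_0^∞ K(z,y) g(z) dz dy`. -/
def Sop (K : ℝ → ℝ → ℝ≥0∞) (g : ℝ → ℝ≥0∞) (x : ℝ) : ℝ≥0∞ :=
  ∫⁻ y in Ioo (0:ℝ) x, ∫⁻ z in Ioi (0:ℝ), K z y * g z

theorem monotone_indicator_Ioi {φ : ℝ → ℝ} (hφ : MonotoneOn φ (Ioi 0))
    (hφ0 : MapsTo φ (Ioi 0) (Ioi 0)) : Monotone ((Ioi 0).indicator φ) := by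
  intro a b hab
  by_cases ha : a ∈ Ioi 0
  · have hb : b ∈ Ioi 0 := lt_of_lt_of_le ha hab
    simpa [ha, hb] using hφ ha hb hab
  · rw [indicator_of_notMem ha]
    exact indicator_nonneg (fun z hz => (hφ0 hz).le) b

/-- Cutting the rectangle `(0, x] × (0, y]` along the graph of `φ`. -/
theorem lintegral_min_add_lintegral_min_inverse {φ ψ : ℝ → ℝ}
    (hφ : StrictMonoOn φ (Ioi 0)) (hφ0 : MapsTo φ (Ioi 0) (Ioi 0))
    (hψ0 : MapsTo ψ (Ioi 0) (Ioi 0)) (hinv : InvOn ψ φ (Ioi 0) (Ioi 0)) (x y : ℝ) :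
    (∫⁻ s in Ioc 0 x, ENNReal.ofReal (min y (φ s))) +
      (∫⁻ t in Ioc 0 y, ENNReal.ofReal (min x (ψ t))) = ENNReal.ofReal x * ENNReal.ofReal y := by
  have hmono := monotone_indicator_Ioi hφ.monotoneOn hφ0
  have hB : MeasurableSet {p : ℝ × ℝ | p.2 ≤ (Ioi 0).indicator φ p.1} :=
    measurableSet_le measurable_snd (hmono.measurable.comp measurable_fst)
  have h := measure_add_measure_compl
    (μ := (volume.restrict (Ioc 0 x)).prod (volume.restrict (Ioc 0 y))) hB
  rw [Measure.prod_apply hB, Measure.prod_apply_symm hB.compl, Measure.prod_apply .univ] at h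
  simp only [preimage_univ, Measure.restrict_apply_univ, lintegral_const, Real.volume_Ioc,
    sub_zero] at h
  rw [mul_comm (ENNReal.ofReal x), ← h]
  congr 1
  · refine setLIntegral_congr_fun measurableSet_Ioc fun s hs => ?_
    have : (Prod.mk s ⁻¹' {p : ℝ × ℝ | p.2 ≤ (Ioi 0).indicator φ p.1}) ∩ Ioc 0 y =
        Ioc 0 (min y (φ s)) := by
      ext t
      simp [indicator_of_mem (show s ∈ Ioi 0 from hs.1)]
      tauto
    rw [Measure.restrict_apply (measurable_prodMk_left hB), this, Real.volume_Ioc, sub_zero]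
  · refine setLIntegral_congr_fun measurableSet_Ioc fun t ht => ?_
    have ht0 : t ∈ Ioi 0 := ht.1
    have h1 : Ioo 0 (min x (ψ t)) ⊆
        ((fun s => (s, t)) ⁻¹' {p : ℝ × ℝ | p.2 ≤ (Ioi 0).indicator φ p.1}ᶜ) ∩ Ioc 0 x := by
      rintro s ⟨hs0, hs⟩
      have hs' : s ∈ Ioi 0 := hs0
      refine ⟨?_, hs0, (hs.trans_le (min_le_left _ _)).le⟩
      have := hφ hs' (hψ0 ht0) (hs.trans_le (min_le_right _ _))
      rw [hinv.2 ht0] at this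
      simpa [hs'] using this
    have h2 : ((fun s => (s, t)) ⁻¹' {p : ℝ × ℝ | p.2 ≤ (Ioi 0).indicator φ p.1}ᶜ) ∩ Ioc 0 x ⊆
        Ioc 0 (min x (ψ t)) := by
      rintro s ⟨hst, hs0, hs⟩
      have hs' : s ∈ Ioi 0 := hs0
      have hlt : φ s < φ (ψ t) := by
        rw [hinv.2 ht0]
        simpa [indicator_of_mem hs'] using hst
      exact ⟨hs0, le_min hs ((hφ.lt_iff_lt hs' (hψ0 ht0)).1 hlt).le⟩
    rw [Measure.restrict_apply (measurable_prodMk_right hB.compl)]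
    refine le_antisymm ?_ ?_
    · simpa using measure_mono (μ := volume) h1
    · simpa using measure_mono (μ := volume) h2

theorem IsNFunction.ofReal_eq_lintegral {F φ : ℝ → ℝ} (h : IsNFunction F φ) {x : ℝ}
    (hx : 0 ≤ x) : ENNReal.ofReal (F x) = ∫⁻ s in Ioc 0 x, ENNReal.ofReal (φ s) := by
  obtain ⟨hmono, hmaps, -, hF⟩ := h
  rw [hF x hx, intervalIntegral.integral_of_le hx]
  refine ofReal_integral_eq_lintegral_ofReal ?_ ?_
  · have hm := monotone_indicator_Ioi hmono.monotoneOn hmaps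
    have hi := (intervalIntegrable_iff_integrableOn_Ioc_of_le hx).1
      (hm.intervalIntegrable (μ := volume) (a := 0) (b := x))
    exact hi.congr_fun (fun s hs => indicator_of_mem (show s ∈ Ioi 0 from hs.1) φ)
      measurableSet_Ioc
  · exact (ae_restrict_mem measurableSet_Ioc).mono fun s hs => (hmaps hs.1).le

/-- A pair of gauge functions on `[0, ∞]` satisfying Young's inequality, with equality along the
graph of `d`. -/
structure IsYoungPair (P Q d : ℝ≥0∞ → ℝ≥0∞) : Prop where
  mul_le : ∀ a b, a * b ≤ P a + Q b
  mul_eq : ∀ a, a ≠ ⊤ → a * d a = P a + Q (d a)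
  map_top : P ⊤ = ⊤
  ne_top : ∀ a, a ≠ ⊤ → P a ≠ ⊤
  ne_top' : ∀ b, b ≠ ⊤ → Q b ≠ ⊤
  density_ne_top : ∀ a, a ≠ ⊤ → d a ≠ ⊤
  density_ne_zero : ∀ a, a ≠ 0 → d a ≠ 0
  density_mono : Monotone d
  density_zero : d 0 = 0

/-- The density of an N-function, extended to `[0, ∞]` with value `0` at `0`. -/
def extDensity (φ : ℝ → ℝ) (a : ℝ≥0∞) : ℝ≥0∞ := if a = 0 then 0 else extE φ a

theorem IsNFunction.map_zero {F φ : ℝ → ℝ} (h : IsNFunction F φ) : F 0 = 0 := by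
  rw [h.2.2.2 0 le_rfl, intervalIntegral.integral_same]

theorem IsComplementary.isYoungPair {F φ G ψ : ℝ → ℝ} (h : IsComplementary F φ G ψ) :
    IsYoungPair (extE F) (extE G) (extDensity φ) := by
  obtain ⟨hF, hG, hinv⟩ := h
  have hcut := lintegral_min_add_lintegral_min_inverse hF.1 hF.2.1 hG.2.1 hinv
  have hE : ∀ H : ℝ → ℝ, ∀ a, a ≠ ⊤ → extE H a = ENNReal.ofReal (H a.toReal) :=
    fun H a ha => if_neg ha
  have hT : ∀ H : ℝ → ℝ, extE H ⊤ = ⊤ := fun H => if_pos rfl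
  have hpos : ∀ a : ℝ≥0∞, a ≠ 0 → a ≠ ⊤ → 0 < φ a.toReal := fun a h0 ht =>
    hF.2.1 (ENNReal.toReal_pos h0 ht)
  refine ⟨fun a b => ?_, fun a ha => ?_, hT F, fun a ha => by simp [hE F a ha],
    fun a ha => by simp [hE G a ha], fun a ha => ?_, fun a h0 => ?_, fun a b hab => ?_, if_pos rfl⟩
  · rcases eq_or_ne a ⊤ with rfl | ha
    · simp [hT]
    rcases eq_or_ne b ⊤ with rfl | hb
    · simp [hT]
    rw [hE F a ha, hE G b hb, hF.ofReal_eq_lintegral ENNReal.toReal_nonneg,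
      hG.ofReal_eq_lintegral ENNReal.toReal_nonneg]
    calc a * b = ENNReal.ofReal a.toReal * ENNReal.ofReal b.toReal := by
          rw [ENNReal.ofReal_toReal ha, ENNReal.ofReal_toReal hb]
      _ ≤ _ := by
        rw [← hcut]
        gcongr
        · exact min_le_right _ _
        · exact min_le_right _ _
  · rcases eq_or_ne a 0 with rfl | h0
    · simp [extDensity, hE, hF.map_zero, hG.map_zero]
    have hx : a.toReal ∈ Ioi 0 := ENNReal.toReal_pos h0 ha
    have hd : extDensity φ a = ENNReal.ofReal (φ a.toReal) := by
      rw [extDensity, if_neg h0, hE φ a ha]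
    rw [hd, hE F a ha, hE G _ ENNReal.ofReal_ne_top,
      ENNReal.toReal_ofReal (hpos a h0 ha).le, hF.ofReal_eq_lintegral hx.le,
      hG.ofReal_eq_lintegral (hpos a h0 ha).le]
    nth_rw 1 [← ENNReal.ofReal_toReal ha]
    rw [← hcut]
    congr 1
    · refine setLIntegral_congr_fun measurableSet_Ioc fun s hs => ?_
      have := hF.1.monotoneOn (show s ∈ Ioi 0 from hs.1) hx hs.2
      simp only [min_eq_right this]
    · refine setLIntegral_congr_fun measurableSet_Ioc fun t ht => ?_
      have := hG.1.monotoneOn (show t ∈ Ioi 0 from ht.1) (hF.2.1 hx) ht.2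
      rw [hinv.1 hx] at this
      simp only [min_eq_right this]
  · unfold extDensity
    split_ifs with h
    · simp
    · simp [hE φ a ha]
  · rw [extDensity, if_neg h0]
    rcases eq_or_ne a ⊤ with rfl | ha
    · simp [hT]
    · rw [hE φ a ha]
      simpa using hpos a h0 ha
  · rcases eq_or_ne a 0 with rfl | h0
    · simp [extDensity]
    have hb0 : b ≠ 0 := (lt_of_lt_of_le (pos_iff_ne_zero.2 h0) hab).ne'
    rcases eq_or_ne b ⊤ with rfl | hb
    · simp [extDensity, hT]
    have ha : a ≠ ⊤ := (lt_of_le_of_lt hab hb.lt_top).ne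
    rw [extDensity, extDensity, if_neg h0, if_neg hb0, hE φ a ha, hE φ b hb]
    exact ENNReal.ofReal_le_ofReal (hF.1.monotoneOn (ENNReal.toReal_pos h0 ha)
      (ENNReal.toReal_pos hb0 hb) (ENNReal.toReal_mono hb hab))

theorem IsComplementary.symm {F φ G ψ : ℝ → ℝ} (h : IsComplementary F φ G ψ) :
    IsComplementary G ψ F φ :=
  ⟨h.2.1, h.1, h.2.2.symm⟩

namespace IsYoungPair

variable {P Q d : ℝ≥0∞ → ℝ≥0∞}

theorem monotone (h : IsYoungPair P Q d) : Monotone P := by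
  intro a b hab
  rcases eq_or_ne b ⊤ with rfl | hb
  · simp [h.map_top]
  have ha : a ≠ ⊤ := (lt_of_le_of_lt hab hb.lt_top).ne
  have h1 : P a + Q (d a) ≤ P b + Q (d a) := by
    rw [← h.mul_eq a ha]
    exact (mul_le_mul_left hab _).trans (h.mul_le _ _)
  exact (ENNReal.add_le_add_iff_right (h.ne_top' _ (h.density_ne_top a ha))).1 h1

theorem map_zero_and_map_zero (h : IsYoungPair P Q d) : P 0 = 0 ∧ Q 0 = 0 := by
  have := h.mul_eq 0 ENNReal.zero_ne_top
  rw [h.density_zero, zero_mul] at this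
  exact add_eq_zero.1 this.symm

theorem map_zero (h : IsYoungPair P Q d) : P 0 = 0 := h.map_zero_and_map_zero.1

theorem map_zero' (h : IsYoungPair P Q d) : Q 0 = 0 := h.map_zero_and_map_zero.2

theorem map_mul_le (h : IsYoungPair P Q d) {θ : ℝ≥0∞} (hθ : θ ≤ 1) (a : ℝ≥0∞) :
    P (θ * a) ≤ θ * P a := by
  rcases eq_or_ne θ 0 with rfl | h0
  · simp [h.map_zero]
  rcases eq_or_ne a ⊤ with rfl | ha
  · simp [h.map_top, ENNReal.mul_top h0]
  have hθa : θ * a ≠ ⊤ := ENNReal.mul_ne_top (hθ.trans_lt ENNReal.one_lt_top).ne ha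
  refine (ENNReal.add_le_add_iff_right (h.ne_top' _ (h.density_ne_top _ hθa))).1 ?_
  calc P (θ * a) + Q (d (θ * a)) = θ * (a * d (θ * a)) := by rw [← h.mul_eq _ hθa, mul_assoc]
    _ ≤ θ * (P a + Q (d (θ * a))) := by gcongr; exact h.mul_le _ _
    _ = θ * P a + θ * Q (d (θ * a)) := mul_add _ _ _
    _ ≤ θ * P a + Q (d (θ * a)) := by
      gcongr
      exact mul_le_of_le_one_left' hθ

theorem eq_zero_of_map_eq_zero (h : IsYoungPair P Q d) {a : ℝ≥0∞} (ha : P a = 0) : a = 0 := by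
  by_contra h0
  have hat : a ≠ ⊤ := by
    rintro rfl
    simp [h.map_top] at ha
  have h2t : a / 2 ≠ ⊤ := ENNReal.div_ne_top hat two_ne_zero
  have h20 : a / 2 ≠ 0 := (ENNReal.half_pos h0).ne'
  have h1 : a * d (a / 2) ≤ a / 2 * d (a / 2) := by
    rw [h.mul_eq _ h2t]
    refine (h.mul_le _ _).trans ?_
    rw [ha, zero_add]
    exact le_add_self
  have h2 := (ENNReal.mul_le_mul_iff_left (h.density_ne_zero _ h20) (h.density_ne_top _ h2t)).1 h1
  exact absurd (ENNReal.half_lt_self h0 hat) (not_lt.2 h2)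

theorem tendsto_nat (h : IsYoungPair P Q d) :
    Filter.Tendsto (fun n : ℕ => P n) Filter.atTop (nhds ⊤) := by
  have h1 : Filter.Tendsto (fun n : ℕ => (n : ℝ≥0∞) - Q 1) Filter.atTop (nhds ⊤) := by
    have := ENNReal.Tendsto.sub ENNReal.tendsto_nat_nhds_top
      (tendsto_const_nhds (x := Q 1)) (Or.inr (h.ne_top' 1 ENNReal.one_ne_top))
    rwa [ENNReal.top_sub (h.ne_top' 1 ENNReal.one_ne_top)] at this
  refine tendsto_nhds_top_mono' h1 fun n => ?_
  have := h.mul_le n 1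
  rw [mul_one] at this
  exact tsub_le_iff_right.2 this

end IsYoungPair

/-- If the pairing of `h` with every `g` of `Q`-modular at most one is bounded by `M`, then `h / M`
has `P`-modular at most one. -/
theorem IsYoungPair.lintegral_le_one_of_pairing_le {P Q d d' : ℝ≥0∞ → ℝ≥0∞}
    (hPQ : IsYoungPair P Q d) (hQP : IsYoungPair Q P d') {h w : ℝ → ℝ≥0∞}
    (hh : Measurable h) (hw : Measurable w) (hwloc : ∀ a > 0, ∀ b, ∫⁻ x in Ioc a b, w x ≠ ⊤)
    {M : ℝ≥0∞} (hM0 : M ≠ 0) (hMt : M ≠ ⊤)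
    (hpair : ∀ g : ℝ → ℝ≥0∞, Measurable g → ∫⁻ x in Ioi (0 : ℝ), Q (g x) * w x ≤ 1 →
      ∫⁻ x in Ioi (0 : ℝ), h x * (g x * w x) ≤ M) :
    ∫⁻ x in Ioi (0 : ℝ), P (h x / M) * w x ≤ 1 := by
  have hPm : Measurable P := hPQ.monotone.measurable
  have hQm : Measurable Q := hQP.monotone.measurable
  have hdm : Measurable d := hPQ.density_mono.measurable
  set E : ℕ → Set ℝ := fun n => Ioc (1 / ((n : ℝ) + 1)) n with hE
  set H : ℕ → ℝ → ℝ≥0∞ := fun n => (E n).indicator fun x => min (h x / M) n with hH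
  have hHm : ∀ n, Measurable (H n) := fun n =>
    ((hh.div_const M).min measurable_const).indicator measurableSet_Ioc
  have hHt : ∀ n x, H n x ≠ ⊤ := fun n x => by
    by_cases hx : x ∈ E n
    · simp [hH, hx]
    · simp [hH, hx]
  have hHle : ∀ n x, H n x ≤ h x / M := fun n x => by
    by_cases hx : x ∈ E n
    · simp [hH, hx]
    · simp [hH, hx]
  have hone : ∀ n, ∫⁻ x in Ioi (0 : ℝ), P (H n x) * w x ≤ 1 := by
    intro n
    set m := ∫⁻ x in Ioi (0 : ℝ), Q (d (H n x)) * w x with hm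
    have hmt : m ≠ ⊤ := by
      have hle : m ≤ ∫⁻ x, (E n).indicator (fun x => Q (d n) * w x) x := by
        rw [hm]
        refine (setLIntegral_le_lintegral _ _).trans (lintegral_mono fun x => ?_)
        by_cases hx : x ∈ E n
        · simp only [hH, indicator_of_mem hx]
          gcongr
          exact hQP.monotone (hPQ.density_mono (min_le_right _ _))
        · simp [hH, hx, hPQ.density_zero, hPQ.map_zero']
      refine (hle.trans_lt ?_).ne
      rw [lintegral_indicator measurableSet_Ioc, lintegral_const_mul _ hw]
      exact ENNReal.mul_lt_top
        (hPQ.ne_top' _ (hPQ.density_ne_top _ (ENNReal.natCast_ne_top n))).lt_top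
        (hwloc _ (by positivity) _).lt_top
    have hsum : (∫⁻ x in Ioi (0 : ℝ), P (H n x) * w x) + m
        = ∫⁻ x in Ioi (0 : ℝ), H n x * (d (H n x) * w x) := by
      have hmeas : Measurable fun x => P (H n x) * w x := (hPm.comp (hHm n)).mul hw
      rw [hm, ← lintegral_add_left hmeas]
      refine lintegral_congr fun x => ?_
      rw [← add_mul, ← hPQ.mul_eq _ (hHt n x), mul_assoc]
    have hbound : ∀ c : ℝ≥0∞, c ≠ ⊤ → 1 ≤ c → m ≤ c →
        ∫⁻ x in Ioi (0 : ℝ), H n x * (d (H n x) * w x) ≤ c := by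
      intro c hct hc1 hmc
      have hc0 : c ≠ 0 := (zero_lt_one.trans_le hc1).ne'
      have h1 : ∫⁻ x in Ioi (0 : ℝ), Q (c⁻¹ * d (H n x)) * w x ≤ 1 := by
        calc ∫⁻ x in Ioi (0 : ℝ), Q (c⁻¹ * d (H n x)) * w x
            ≤ ∫⁻ x in Ioi (0 : ℝ), c⁻¹ * (Q (d (H n x)) * w x) := by
              refine lintegral_mono fun x => ?_
              rw [← mul_assoc]
              gcongr
              exact hQP.map_mul_le (ENNReal.inv_le_one.2 hc1) _
          _ = c⁻¹ * m := lintegral_const_mul _ ((hQm.comp (hdm.comp (hHm n))).mul hw)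
          _ ≤ c⁻¹ * c := by gcongr
          _ = 1 := ENNReal.inv_mul_cancel hc0 hct
      have h2 := hpair _ ((hdm.comp (hHm n)).const_mul c⁻¹) h1
      calc ∫⁻ x in Ioi (0 : ℝ), H n x * (d (H n x) * w x)
          ≤ ∫⁻ x in Ioi (0 : ℝ), (c * M⁻¹) * (h x * (c⁻¹ * d (H n x) * w x)) := by
            refine lintegral_mono fun x => ?_
            calc H n x * (d (H n x) * w x) ≤ h x / M * (d (H n x) * w x) := by
                  gcongr
                  exact hHle n x
              _ = (c * c⁻¹) * (h x / M * (d (H n x) * w x)) := by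
                  rw [ENNReal.mul_inv_cancel hc0 hct, one_mul]
              _ = _ := by rw [div_eq_mul_inv]; ring
        _ = (c * M⁻¹) * ∫⁻ x in Ioi (0 : ℝ), h x * (c⁻¹ * d (H n x) * w x) :=
            lintegral_const_mul _ (hh.mul (((hdm.comp (hHm n)).const_mul _).mul hw))
        _ ≤ (c * M⁻¹) * M := by gcongr; exact h2
        _ = c := by rw [mul_assoc, ENNReal.inv_mul_cancel hM0 hMt, mul_one]
    rcases le_total m 1 with hm1 | hm1
    · exact le_self_add.trans (hsum.trans_le (hbound 1 ENNReal.one_ne_top le_rfl hm1))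
    · have := hsum.trans_le (hbound m hmt hm1 le_rfl)
      have h0 : ∫⁻ x in Ioi (0 : ℝ), P (H n x) * w x ≤ 0 :=
        (ENNReal.add_le_add_iff_right hmt).1 (this.trans_eq (zero_add m).symm)
      exact h0.trans zero_le_one
  have hlim : ∀ x ∈ Ioi (0 : ℝ), P (h x / M) * w x ≤
      Filter.liminf (fun n => P (H n x) * w x) Filter.atTop := by
    intro x hx
    have hxE : ∀ᶠ n : ℕ in Filter.atTop, H n x = min (h x / M) n := by
      have h1 := (tendsto_one_div_add_atTop_nhds_zero_nat (𝕜 := ℝ)).eventually_lt_const hx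
      have h2 := tendsto_natCast_atTop_atTop.eventually_ge_atTop x
      filter_upwards [h1, h2] with n h1 h2
      exact indicator_of_mem (show x ∈ E n from ⟨h1, h2⟩) _
    rcases eq_or_ne (h x / M) ⊤ with ht | ht
    · rcases eq_or_ne (w x) 0 with hw0 | hw0
      · simp [hw0]
      have : Filter.Tendsto (fun n => P (H n x) * w x) Filter.atTop (nhds (⊤ * w x)) := by
        refine ENNReal.Tendsto.mul_const ?_ (Or.inl ENNReal.top_ne_zero)
        refine hPQ.tendsto_nat.congr' ?_
        filter_upwards [hxE] with n hn
        rw [hn, ht, min_eq_right le_top]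
      rw [this.liminf_eq, ht, hPQ.map_top]
    · have : Filter.Tendsto (fun n => P (H n x) * w x) Filter.atTop
          (nhds (P (h x / M) * w x)) := by
        refine tendsto_const_nhds.congr' ?_
        have h3 := ENNReal.tendsto_nat_nhds_top.eventually_const_lt ht.lt_top
        filter_upwards [hxE, h3] with n hn h3
        rw [hn, min_eq_left h3.le]
      rw [this.liminf_eq]
  calc ∫⁻ x in Ioi (0 : ℝ), P (h x / M) * w x
      ≤ ∫⁻ x in Ioi (0 : ℝ), Filter.liminf (fun n => P (H n x) * w x) Filter.atTop :=
        setLIntegral_mono' measurableSet_Ioi hlim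
    _ ≤ Filter.liminf (fun n => ∫⁻ x in Ioi (0 : ℝ), P (H n x) * w x) Filter.atTop :=
        lintegral_liminf_le fun n => (hPm.comp (hHm n)).mul hw
    _ ≤ Filter.liminf (fun _ : ℕ => (1 : ℝ≥0∞)) Filter.atTop :=
        Filter.liminf_le_liminf (Filter.Eventually.of_forall hone)
    _ = 1 := Filter.liminf_const 1

theorem lintegral_Ioc_eq_ofReal_Uw {u : ℝ → ℝ} (hu : IsWeight u) {x : ℝ} (hx : 0 ≤ x)
    (hfin : ∫⁻ t in Ioc 0 x, ENNReal.ofReal (u t) ≠ ⊤) :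
    IntegrableOn u (Ioc 0 x) ∧
      ∫⁻ t in Ioc 0 x, ENNReal.ofReal (u t) = ENNReal.ofReal (Uw u x) := by
  have hi : IntegrableOn u (Ioc 0 x) :=
    (lintegral_ofReal_ne_top_iff_integrable hu.1.aestronglyMeasurable
      (Filter.Eventually.of_forall hu.2.1)).1 hfin
  refine ⟨hi, ?_⟩
  rw [Uw, intervalIntegral.integral_of_le hx,
    ofReal_integral_eq_lintegral_ofReal hi (Filter.Eventually.of_forall hu.2.1)]

theorem IsWeight.lintegral_Ioc_ne_top {u : ℝ → ℝ} (hu : IsWeight u) {a : ℝ} (ha : 0 < a) (b : ℝ) :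
    ∫⁻ t in Ioc a b, ENNReal.ofReal (u t) ≠ ⊤ := by
  have hi : IntegrableOn u (Icc a b) :=
    hu.2.2.integrableOn_compact_subset (fun t ht => ha.trans_le ht.1) isCompact_Icc
  exact (lintegral_ofReal_ne_top_iff_integrable hu.1.aestronglyMeasurable
    (Filter.Eventually.of_forall hu.2.1)).2 (hi.mono_set Ioc_subset_Icc_self)

theorem exists_lintegral_Ioc_eq {u : ℝ → ℝ} (hu : IsWeight u)
    (hfin : ∀ x, ∫⁻ t in Ioc 0 x, ENNReal.ofReal (u t) ≠ ⊤)
    (htop : ∫⁻ t in Ioi (0 : ℝ), ENNReal.ofReal (u t) = ⊤) {r : ℝ≥0∞} (hr0 : r ≠ 0)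
    (hrt : r ≠ ⊤) : ∃ x > 0, ∫⁻ t in Ioc 0 x, ENNReal.ofReal (u t) = r := by
  have hU : ⋃ n : ℕ, Ioc (0 : ℝ) n = Ioi 0 := by
    ext t
    simp only [mem_iUnion, mem_Ioc, mem_Ioi]
    exact ⟨fun ⟨_, h, _⟩ => h, fun h => (exists_nat_ge t).imp fun n hn => ⟨h, hn⟩⟩
  have hdir : Directed (· ⊆ ·) fun n : ℕ => Ioc (0 : ℝ) n :=
    (monotone_nat_of_le_succ fun n => Ioc_subset_Ioc_right (by simp)).directed_le
  rw [← hU, setLIntegral_iUnion_of_directed _ hdir] at htop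
  obtain ⟨N, hN⟩ := lt_iSup_iff.1 (htop ▸ hrt.lt_top)
  obtain ⟨hi, hV⟩ := lintegral_Ioc_eq_ofReal_Uw hu N.cast_nonneg (hfin N)
  have hcont : ContinuousOn (Uw u) (Icc 0 (N : ℝ)) := by
    have := intervalIntegral.continuousOn_primitive_interval (μ := volume) (a := 0) (b := (N : ℝ))
      (f := u) (by rwa [uIcc_of_le N.cast_nonneg, integrableOn_Icc_iff_integrableOn_Ioc])
    rwa [uIcc_of_le N.cast_nonneg] at this
  have h0 : Uw u 0 = 0 := intervalIntegral.integral_same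
  have hmem : r.toReal ∈ Icc (Uw u 0) (Uw u N) := by
    refine ⟨h0.trans_le ENNReal.toReal_nonneg, ?_⟩
    rw [hV] at hN
    exact (ENNReal.le_ofReal_iff_toReal_le hrt (intervalIntegral.integral_nonneg N.cast_nonneg
      fun t _ => hu.2.1 t)).1 hN.le
  obtain ⟨x, hx, hxr⟩ := intermediate_value_Icc N.cast_nonneg hcont hmem
  refine ⟨x, lt_of_le_of_ne hx.1 ?_, ?_⟩
  · rintro rfl
    rw [h0] at hxr
    exact (ENNReal.toReal_pos hr0 hrt).ne hxr
  · rw [(lintegral_Ioc_eq_ofReal_Uw hu hx.1 (hfin x)).2, hxr, ENNReal.ofReal_toReal hrt]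

/-- Young's inequality along a dyadic partition with respect to the measure `w dx`. -/
theorem IsYoungPair.lintegral_antitone_mul_le {P Q d : ℝ≥0∞ → ℝ≥0∞} (h : IsYoungPair P Q d)
    {w f k : ℝ → ℝ≥0∞} (hw : Measurable w) (hk : Measurable k) (hf : Antitone f)
    (hfin : ∀ t, ∫⁻ s in Ioc 0 t, w s ≠ ⊤) {x : ℤ → ℝ} (hx0 : ∀ j, 0 < x j)
    (hx : ∀ j, ∫⁻ s in Ioc 0 (x j), w s = 2 ^ j) {D : ℝ≥0∞} (hD0 : D ≠ 0) (hDt : D ≠ ⊤)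
    (hP : ∫⁻ t in Ioi (0 : ℝ), P (f t) * w t ≤ 1)
    (hQ : ∫⁻ t in Ioi (0 : ℝ),
      Q ((∫⁻ s in Ioo 0 t, k s) / (∫⁻ s in Ioc 0 t, w s) / D) * w t ≤ 1) :
    ∫⁻ t in Ioi (0 : ℝ), f t * k t ≤ 2 * D * (8 + P 1 * 2 + 1) := by
  set V : ℝ → ℝ≥0∞ := fun t => ∫⁻ s in Ioc 0 t, w s with hV
  set S : ℝ → ℝ≥0∞ := fun t => ∫⁻ s in Ioo 0 t, k s with hS
  have hVx : ∀ j, V (x j) = 2 ^ j := hx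
  have hVm : Monotone V := fun a b hab => lintegral_mono_set (Ioc_subset_Ioc_right hab)
  have hSm : Monotone S := fun a b hab => lintegral_mono_set (Ioo_subset_Ioo_right hab)
  have h20 : ∀ j : ℤ, (2 : ℝ≥0∞) ^ j ≠ 0 := fun j =>
    (ENNReal.zpow_pos two_ne_zero ENNReal.ofNat_ne_top j).ne'
  have h2t : ∀ j : ℤ, (2 : ℝ≥0∞) ^ j ≠ ⊤ := fun j =>
    (ENNReal.zpow_lt_top two_ne_zero ENNReal.ofNat_ne_top j).ne
  have h2s : ∀ j : ℤ, (2 : ℝ≥0∞) ^ (j + 1) = 2 * 2 ^ j := fun j => by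
    rw [ENNReal.zpow_add two_ne_zero ENNReal.ofNat_ne_top, zpow_one, mul_comm]
  have h2lt : ∀ j : ℤ, (2 : ℝ≥0∞) ^ j < 2 ^ (j + 1) := fun j => by
    rw [h2s, two_mul]
    exact ENNReal.lt_add_right (h2t j) (h20 j)
  have hlt : ∀ j t, V t < 2 ^ j → t < x j := fun j t ht => by
    by_contra! hc
    exact absurd (hVm hc) (by rw [hVx]; exact not_le.2 ht)
  have hgt : ∀ j t, 2 ^ j < V t → x j < t := fun j t ht => by
    by_contra! hc
    exact absurd (hVm hc) (by rw [hVx]; exact not_le.2 ht)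
  have hxm : Monotone x := monotone_int_of_le_succ fun j =>
    (hlt (j + 1) (x j) (by rw [hVx]; exact h2lt j)).le
  set I : ℤ → Set ℝ := fun j => Ioc (x j) (x (j + 1)) with hI
  have hIpos : ∀ j, I j ⊆ Ioi 0 := fun j t ht => (hx0 j).trans ht.1
  have hIw : ∀ j, ∫⁻ t in I j, w t = 2 ^ j := fun j => by
    have hadd : V (x (j + 1)) = V (x j) + ∫⁻ t in I j, w t := by
      simp only [hV, hI]
      rw [← Ioc_union_Ioc_eq_Ioc (hx0 j).le (hxm (by simp : j ≤ j + 1)),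
        lintegral_union measurableSet_Ioc (Ioc_disjoint_Ioc_of_le le_rfl)]
    rw [hVx, hVx, h2s, two_mul] at hadd
    exact ((ENNReal.add_right_inj (h2t j)).1 hadd).symm
  have hdisj : Pairwise (Function.onFun Disjoint I) := hxm.pairwise_disjoint_on_Ioc_succ
  have hsum : ∀ (g : ℝ → ℝ≥0∞) (A : Set ℝ), (∀ j, I j ⊆ A) →
      ∑' j, ∫⁻ t in I j, g t ≤ ∫⁻ t in A, g t := fun g A hA => by
    rw [← lintegral_iUnion (fun j => measurableSet_Ioc) hdisj]
    exact lintegral_mono_set (iUnion_subset hA)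
  set c : ℤ → ℝ≥0∞ := fun j => max (f (x (j - 2))) (if j ≤ 0 then 1 else 0) with hc
  have hpt : ∀ t ∈ Ioi (0 : ℝ), f t ≤ ∑' j, (Ioo 0 (x j)).indicator (fun _ => c j) t := by
    intro t ht
    rcases eq_or_ne (V t) 0 with h0 | h0
    · have hle : ∑' _ : ℕ, (1 : ℝ≥0∞) ≤
          ∑' n : ℕ, (Ioo 0 (x (-(n : ℤ)))).indicator (fun _ => c (-(n : ℤ))) t := by
        refine ENNReal.tsum_le_tsum fun n => ?_
        rw [indicator_of_mem (show t ∈ Ioo 0 (x (-(n : ℤ))) from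
          ⟨ht, hlt _ _ (by rw [h0]; exact pos_iff_ne_zero.2 (h20 _))⟩)]
        exact le_max_of_le_right (by simp)
      rw [ENNReal.tsum_const_eq_top_of_ne_zero one_ne_zero, top_le_iff] at hle
      refine le_top.trans (hle.symm.le.trans (ENNReal.tsum_comp_le_tsum_of_injective
        (f := fun n : ℕ => -(n : ℤ)) (fun a b hab => by simpa using hab) _))
    · obtain ⟨j, hj1, hj2⟩ := ENNReal.exists_mem_Ico_zpow h0 (hfin t) ENNReal.one_lt_two
        ENNReal.ofNat_ne_top
      refine le_trans ?_ (ENNReal.le_tsum (j + 1))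
      rw [indicator_of_mem (show t ∈ Ioo 0 (x (j + 1)) from ⟨ht, hlt _ _ hj2⟩)]
      refine le_max_of_le_left (hf (hgt _ _ (lt_of_lt_of_le ?_ hj1)).le)
      have := h2lt (j + 1 - 2)
      rwa [show j + 1 - 2 + 1 = j by ring] at this
  have hterm : ∀ j, c j * S (x j) ≤ 2 * D * ((∫⁻ t in I j, P (c j) * w t) +
      ∫⁻ t in I j, Q (S t / V t / D) * w t) := by
    intro j
    rw [← lintegral_add_left (hw.const_mul _), ← lintegral_const_mul' _ _
      (ENNReal.mul_ne_top ENNReal.ofNat_ne_top hDt)]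
    calc c j * S (x j) = (c j * S (x j) * (2 ^ j)⁻¹) * ∫⁻ t in I j, w t := by
          rw [hIw, mul_assoc, ENNReal.inv_mul_cancel (h20 j) (h2t j), mul_one]
      _ = ∫⁻ t in I j, (c j * S (x j) * (2 ^ j)⁻¹) * w t := (lintegral_const_mul _ hw).symm
      _ ≤ _ := by
        refine setLIntegral_mono' measurableSet_Ioc fun t ht => ?_
        have h1 : V t ≤ 2 * 2 ^ j := by
          rw [← h2s, ← hVx]
          exact hVm ht.2
        have h2 : ((2 : ℝ≥0∞) ^ j)⁻¹ ≤ 2 * (V t)⁻¹ := by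
          calc ((2 : ℝ≥0∞) ^ j)⁻¹ = 2 * (2 * 2 ^ j)⁻¹ := by
                rw [ENNReal.mul_inv (Or.inl two_ne_zero) (Or.inl ENNReal.ofNat_ne_top),
                  ← mul_assoc, ENNReal.mul_inv_cancel two_ne_zero ENNReal.ofNat_ne_top, one_mul]
            _ ≤ 2 * (V t)⁻¹ := by gcongr
        rw [← add_mul, ← mul_assoc]
        refine mul_le_mul_left ?_ (w t)
        calc c j * S (x j) * (2 ^ j)⁻¹ ≤ c j * S t * (2 * (V t)⁻¹) := by
              gcongr
              exact hSm ht.1.le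
          _ = (D * D⁻¹) * (c j * S t * (2 * (V t)⁻¹)) := by
              rw [ENNReal.mul_inv_cancel hD0 hDt, one_mul]
          _ = 2 * D * (c j * (S t / V t / D)) := by
              simp only [div_eq_mul_inv]
              ring
          _ ≤ 2 * D * (P (c j) + Q (S t / V t / D)) := by
              gcongr
              exact h.mul_le _ _
  have hPc : ∀ j, ∫⁻ t in I j, P (c j) * w t ≤
      8 * (∫⁻ t in I (j - 3), P (f t) * w t) +
        P 1 * ∫⁻ t in I j, (Ioc 0 (x 1)).indicator w t := by
    intro j
    have h1 : P (c j) ≤ P (f (x (j - 2))) + if j ≤ 0 then P 1 else 0 := by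
      rw [hc, h.monotone.map_max]
      split_ifs
      · exact max_le_add_of_nonneg zero_le zero_le
      · simp [h.map_zero]
    have h2 : P (f (x (j - 2))) * 2 ^ j ≤ 8 * ∫⁻ t in I (j - 3), P (f t) * w t := by
      have h8 : (2 : ℝ≥0∞) ^ j = 8 * 2 ^ (j - 3) := by
        conv_lhs => rw [show j = j - 3 + 1 + 1 + 1 by ring, h2s, h2s, h2s, ← mul_assoc, ← mul_assoc]
        norm_num
      rw [h8, mul_left_comm, ← hIw, ← lintegral_const_mul _ hw]
      refine mul_le_mul_right (setLIntegral_mono' measurableSet_Ioc fun t ht => ?_) _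
      gcongr
      refine h.monotone (hf (ht.2.trans_eq ?_))
      congr 1
      ring
    have h3 : (if j ≤ 0 then P 1 else 0) * 2 ^ j ≤
        P 1 * ∫⁻ t in I j, (Ioc 0 (x 1)).indicator w t := by
      split_ifs with hj
      · rw [← hIw]
        refine mul_le_mul_right (setLIntegral_mono' measurableSet_Ioc fun t ht => ?_) _
        rw [indicator_of_mem (show t ∈ Ioc 0 (x 1) from
          ⟨(hx0 j).trans ht.1, ht.2.trans (hxm (by lia))⟩)]
      · simp
    rw [lintegral_const_mul _ hw, hIw]
    calc P (c j) * 2 ^ j ≤ (P (f (x (j - 2))) + if j ≤ 0 then P 1 else 0) * 2 ^ j := by gcongr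
      _ ≤ _ := by
        rw [add_mul]
        exact add_le_add h2 h3
  have hsumP : ∑' j, ∫⁻ t in I j, P (c j) * w t ≤ 8 + P 1 * 2 := by
    refine (ENNReal.tsum_le_tsum hPc).trans ?_
    rw [ENNReal.tsum_add, ENNReal.tsum_mul_left, ENNReal.tsum_mul_left]
    gcongr
    · have := (Equiv.subRight (3 : ℤ)).tsum_eq fun j => ∫⁻ t in I j, P (f t) * w t
      simp only [Equiv.subRight_apply] at this
      rw [this]
      exact mul_le_of_le_one_right' ((hsum _ _ hIpos).trans hP)
    · refine (hsum _ univ fun j => subset_univ _).trans ?_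
      rw [Measure.restrict_univ, lintegral_indicator measurableSet_Ioc, hx, zpow_one]
  calc ∫⁻ t in Ioi (0 : ℝ), f t * k t
      ≤ ∫⁻ t in Ioi (0 : ℝ), ∑' j, (Ioo 0 (x j)).indicator (fun t => c j * k t) t := by
        refine setLIntegral_mono' measurableSet_Ioi fun t ht => ?_
        refine (mul_le_mul_left (hpt t ht) _).trans_eq ?_
        rw [← ENNReal.tsum_mul_right]
        refine tsum_congr fun j => ?_
        by_cases hm : t ∈ Ioo 0 (x j)
        · simp [hm]
        · simp only [indicator_of_notMem hm, zero_mul]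
    _ = ∑' j, ∫⁻ t in Ioi (0 : ℝ), (Ioo 0 (x j)).indicator (fun t => c j * k t) t :=
        lintegral_tsum fun j => ((hk.const_mul _).indicator measurableSet_Ioo).aemeasurable
    _ = ∑' j, c j * S (x j) := by
        refine tsum_congr fun j => ?_
        rw [lintegral_indicator measurableSet_Ioo, Measure.restrict_restrict measurableSet_Ioo,
          inter_eq_left.2 Ioo_subset_Ioi_self, lintegral_const_mul _ hk]
    _ ≤ ∑' j, 2 * D * ((∫⁻ t in I j, P (c j) * w t) +
          ∫⁻ t in I j, Q (S t / V t / D) * w t) := ENNReal.tsum_le_tsum hterm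
    _ = 2 * D * ((∑' j, ∫⁻ t in I j, P (c j) * w t) +
          ∑' j, ∫⁻ t in I j, Q (S t / V t / D) * w t) := by
        rw [ENNReal.tsum_mul_left, ENNReal.tsum_add]
    _ ≤ 2 * D * (8 + P 1 * 2 + 1) := by
        gcongr
        exact (hsum _ _ hIpos).trans hQ

theorem rearr_antitone (f : ℝ → ℝ≥0∞) : Antitone (rearr f) := fun _ _ hst =>
  sInf_le_sInf fun _ hl => le_trans hl (ENNReal.ofReal_le_ofReal hst)

theorem measurable_TK {K : ℝ → ℝ → ℝ≥0∞} (hK : Measurable (Function.uncurry K)) {f : ℝ → ℝ≥0∞}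
    (hf : Measurable f) : Measurable (TK K f) :=
  Measurable.lintegral_prod_right' (f := fun p : ℝ × ℝ => K p.1 p.2 * f p.2)
    (hK.mul (hf.comp measurable_snd))

theorem lintegral_TK_mul {K : ℝ → ℝ → ℝ≥0∞} (hK : Measurable (Function.uncurry K))
    {f G : ℝ → ℝ≥0∞} (hf : Measurable f) (hG : Measurable G) :
    ∫⁻ x in Ioi (0 : ℝ), TK K f x * G x =
      ∫⁻ y in Ioi (0 : ℝ), f y * ∫⁻ z in Ioi (0 : ℝ), K z y * G z := by
  calc ∫⁻ x in Ioi (0 : ℝ), TK K f x * G x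
      = ∫⁻ x in Ioi (0 : ℝ), ∫⁻ y in Ioi (0 : ℝ), K x y * f y * G x :=
        lintegral_congr fun x =>
          (lintegral_mul_const _ ((hK.comp measurable_prodMk_left).mul hf)).symm
    _ = ∫⁻ y in Ioi (0 : ℝ), ∫⁻ x in Ioi (0 : ℝ), K x y * f y * G x :=
        lintegral_lintegral_swap
          ((hK.mul (hf.comp measurable_snd)).mul (hG.comp measurable_fst)).aemeasurable
    _ = _ := by
        refine lintegral_congr fun y => ?_
        refine Eq.trans (lintegral_congr fun z => ?_)
          (lintegral_const_mul _ ((hK.comp measurable_prodMk_right).mul hG))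
        ring

/-- A modular inequality for antitone functions gives the corresponding gauge inequality. -/
theorem ogauge_TK_le_of_modular {K : ℝ → ℝ → ℝ≥0∞} (hK : Measurable (Function.uncurry K))
    {F₁ F₂ u₁ u₂ : ℝ → ℝ} {M : ℝ≥0∞} (hM0 : M ≠ 0) (hMt : M ≠ ⊤)
    (hmod : ∀ f : ℝ → ℝ≥0∞, Antitone f →
      ∫⁻ x in Ioi (0 : ℝ), extE F₂ (f x) * ENNReal.ofReal (u₂ x) ≤ 1 →
      ∫⁻ x in Ioi (0 : ℝ), extE F₁ (TK K f x / M) * ENNReal.ofReal (u₁ x) ≤ 1)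
    {f : ℝ → ℝ≥0∞} (hf : Antitone f) : ogauge F₁ u₁ (TK K f) ≤ M * ogauge F₂ u₂ f := by
  rw [mul_comm, ← ENNReal.div_le_iff hM0 hMt]
  refine le_sInf fun l ⟨hl0, hl⟩ => ?_
  rw [ENNReal.div_le_iff hM0 hMt]
  rcases eq_or_ne l ⊤ with rfl | hlt
  · simp [ENNReal.top_mul hM0]
  refine sInf_le ⟨ENNReal.mul_pos hl0.ne' hM0, ?_⟩
  have hscale : ∀ x, TK K f x / (l * M) = TK K (fun y => f y / l) x / M := fun x => by
    have : TK K (fun y => f y / l) x = TK K f x * l⁻¹ := by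
      simp only [TK, div_eq_mul_inv, ← mul_assoc]
      exact lintegral_mul_const _ ((hK.comp measurable_prodMk_left).mul hf.measurable)
    rw [this, div_eq_mul_inv, div_eq_mul_inv, ENNReal.mul_inv (Or.inl hl0.ne') (Or.inl hlt),
      mul_assoc]
  simp only [hscale]
  exact hmod _ (fun a b hab => ENNReal.div_le_div_right (hf hab) l) hl

theorem IsYoungPair.eq_zero_of_antitone {P Q d : ℝ≥0∞ → ℝ≥0∞} (h : IsYoungPair P Q d)
    {w f : ℝ → ℝ≥0∞} (hw : Measurable w) (hwloc : ∀ a > 0, ∀ b, ∫⁻ x in Ioc a b, w x ≠ ⊤)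
    (hf : Antitone f) {t₀ : ℝ} (htop : ∫⁻ x in Ioc 0 t₀, w x = ⊤)
    (hP : ∫⁻ t in Ioi (0 : ℝ), P (f t) * w t ≤ 1) {t : ℝ} (ht : 0 < t) : f t = 0 := by
  have hV : ∫⁻ x in Ioc 0 t, w x = ⊤ := by
    by_contra hc
    have hsub : Ioc 0 t₀ ⊆ Ioc 0 t ∪ Ioc t t₀ := fun s hs =>
      (le_or_gt s t).imp (fun h => ⟨hs.1, h⟩) fun h => ⟨h, hs.2⟩
    have := (lintegral_mono_set (μ := volume) (f := w) hsub).trans (lintegral_union_le w _ _)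
    rw [htop, top_le_iff] at this
    exact ENNReal.add_ne_top.2 ⟨hc, hwloc t ht t₀⟩ this
  refine h.eq_zero_of_map_eq_zero ?_
  by_contra h0
  have hle : P (f t) * ⊤ ≤ 1 := by
    rw [← hV, ← lintegral_const_mul _ hw]
    refine (setLIntegral_mono' measurableSet_Ioc fun s hs => ?_).trans
      ((lintegral_mono_set Ioc_subset_Ioi_self).trans hP)
    gcongr
    exact h.monotone (hf hs.2)
  rw [ENNReal.mul_top h0] at hle
  exact absurd hle (by simp)

theorem statement0
    (K : ℝ → ℝ → ℝ≥0∞) (hK : Measurable (Function.uncurry K))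
    (Φ₁ φ₁ Φ₂ φ₂ Ψ₁ ψ₁ Ψ₂ ψ₂ : ℝ → ℝ)
    (hΦ₁ : IsNFunction Φ₁ φ₁) (hΦ₂ : IsNFunction Φ₂ φ₂)
    (hΨ₁ : IsComplementary Φ₁ φ₁ Ψ₁ ψ₁) (hΨ₂ : IsComplementary Φ₂ φ₂ Ψ₂ ψ₂)
    (hD₂ : Doubling Φ₂)
    (u₁ u₂ : ℝ → ℝ) (hu₁ : IsWeight u₁) (hu₂ : IsWeight u₂)
    (hu₂top : (∫⁻ x in Ioi (0:ℝ), ENNReal.ofReal (u₂ x)) = ⊤)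
    (hmain : ∃ C > 0, ∀ g : ℝ → ℝ≥0∞, Measurable g →
      ogauge Ψ₂ u₂ (fun x => Sop K g x / ENNReal.ofReal (Uw u₂ x)) ≤
        ENNReal.ofReal C * ogauge Ψ₁ u₁ (fun x => g x / ENNReal.ofReal (u₁ x))) :
    ∃ C > 0, ∀ f : ℝ → ℝ≥0∞, Measurable f →
      ogauge Φ₁ u₁ (TK K (rearr f)) ≤ ENNReal.ofReal C * ogauge Φ₂ u₂ (rearr f) := by
  obtain ⟨C, hC, hS⟩ := hmain
  have hY₁ := hΨ₁.isYoungPair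
  have hY₁' := hΨ₁.symm.isYoungPair
  have hY₂ := hΨ₂.isYoungPair
  have hY₂' := hΨ₂.symm.isYoungPair
  have hw₁ : Measurable fun x => ENNReal.ofReal (u₁ x) := hu₁.1.ennreal_ofReal
  have hw₂ : Measurable fun x => ENNReal.ofReal (u₂ x) := hu₂.1.ennreal_ofReal
  suffices hmod : ∃ M : ℝ≥0∞, M ≠ 0 ∧ M ≠ ⊤ ∧ ∀ f : ℝ → ℝ≥0∞, Antitone f →
      ∫⁻ x in Ioi (0 : ℝ), extE Φ₂ (f x) * ENNReal.ofReal (u₂ x) ≤ 1 →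
      ∫⁻ x in Ioi (0 : ℝ), extE Φ₁ (TK K f x / M) * ENNReal.ofReal (u₁ x) ≤ 1 by
    obtain ⟨M, hM0, hMt, hmod⟩ := hmod
    refine ⟨M.toReal, ENNReal.toReal_pos hM0 hMt, fun f _ => ?_⟩
    rw [ENNReal.ofReal_toReal hMt]
    exact ogauge_TK_le_of_modular hK hM0 hMt hmod (rearr_antitone f)
  by_cases hfin : ∀ t, ∫⁻ s in Ioc 0 t, ENNReal.ofReal (u₂ s) ≠ ⊤
  · choose x hx0 hx using fun j : ℤ => exists_lintegral_Ioc_eq hu₂ hfin hu₂top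
      (ENNReal.zpow_pos two_ne_zero ENNReal.ofNat_ne_top j).ne'
      (ENNReal.zpow_lt_top two_ne_zero ENNReal.ofNat_ne_top j).ne
    set D : ℝ≥0∞ := ENNReal.ofReal (C + 1) with hD
    have hD0 : D ≠ 0 := by simpa [hD] using by linarith
    have hDt : D ≠ ⊤ := ENNReal.ofReal_ne_top
    have hM0 : 2 * D * (8 + extE Φ₂ 1 * 2 + 1) ≠ 0 := by simp [hD0]
    have hMt : 2 * D * (8 + extE Φ₂ 1 * 2 + 1) ≠ ⊤ := by
      have := hY₂.ne_top 1 ENNReal.one_ne_top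
      finiteness
    refine ⟨_, hM0, hMt, fun f hf hf1 => ?_⟩
    refine hY₁.lintegral_le_one_of_pairing_le hY₁' (measurable_TK hK hf.measurable) hw₁
      (fun a ha b => hu₁.lintegral_Ioc_ne_top ha b) hM0 hMt fun g hg hg1 => ?_
    set G : ℝ → ℝ≥0∞ := fun z => g z * ENNReal.ofReal (u₁ z) with hG
    have hGm : Measurable G := hg.mul hw₁
    have hgauge : ogauge Ψ₁ u₁ (fun z => G z / ENNReal.ofReal (u₁ z)) ≤ 1 := by
      refine sInf_le ⟨one_pos, le_trans (lintegral_mono fun z => ?_) hg1⟩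
      gcongr
      refine hY₁'.monotone ?_
      rw [div_one]
      exact ENNReal.div_le_of_le_mul le_rfl
    have hlt : ogauge Ψ₂ u₂ (fun t => Sop K G t / ENNReal.ofReal (Uw u₂ t)) < D := by
      refine ((hS G hGm).trans (mul_le_of_le_one_right' hgauge)).trans_lt ?_
      exact (ENNReal.ofReal_lt_ofReal_iff (by linarith)).2 (by linarith)
    obtain ⟨l, ⟨-, hl⟩, hlD⟩ := sInf_lt_iff.1 hlt
    rw [lintegral_TK_mul hK hf.measurable hGm]
    refine hY₂.lintegral_antitone_mul_le hw₂ ?_ hf hfin hx0 hx hD0 hDt hf1 ?_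
    · exact Measurable.lintegral_prod_left' (f := fun p : ℝ × ℝ => K p.1 p.2 * G p.1)
        (hK.mul (hGm.comp measurable_fst))
    · refine (setLIntegral_mono' measurableSet_Ioi fun t ht => ?_).trans hl
      rw [(lintegral_Ioc_eq_ofReal_Uw hu₂ (le_of_lt ht) (hfin t)).2]
      gcongr
      exact hY₂'.monotone (ENNReal.div_le_div_left hlD.le _)
  · push Not at hfin
    obtain ⟨t₀, ht₀⟩ := hfin
    refine ⟨1, one_ne_zero, ENNReal.one_ne_top, fun f hf hf1 => ?_⟩
    have hT : ∀ x, TK K f x = 0 := fun x => by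
      rw [TK, setLIntegral_congr_fun (g := fun _ => 0) measurableSet_Ioi fun t ht => ?_,
        lintegral_zero]
      simp only [hY₂.eq_zero_of_antitone hw₂ (fun a ha b => hu₂.lintegral_Ioc_ne_top ha b) hf
        ht₀ hf1 ht, mul_zero]
    simp [hT, hY₁.map_zero]

end
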